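/- Assume p01 ≤ p11. Then for every t ∈ {1,…,T} and every ω ∈ [0,1]^n, the optimal value equals the greedy-policy value evaluated at the increasingly sorted state: V_t(ω) = W_t(ω^↑), where ω^↑ denotes the increasing rearrangement of the coordinates of ω. -/

import Mathlib

open Finset

noncomputable section

/-- The one-step belief update for an unobserved channel. -/
def tauF (p01 p11 : ℝ) (w : ℝ) : ℝ := w * p11 + (1 - w) * p01

/-- The set of admissible actions: subsets of `Fin n` of cardinality `k`. -/
def actions (n k : ℕ) : Finset (Finset (Fin n)) :=
  (Finset.univ : Finset (Fin n)).powersetCard k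

lemma actions_nonempty {n k : ℕ} (hk : k ≤ n) : (actions n k).Nonempty := by
  rw [actions, Finset.powersetCard_nonempty, Finset.card_univ, Fintype.card_fin]
  exact hk

/-- Number of `true` entries in a `{0,1}^k` realization. -/
def countTrue {k : ℕ} (l : Fin k → Bool) : ℕ :=
  (Finset.univ.filter fun i => l i = true).card

/-- `q(l; u) = ∏ u_i^{l_i} (1-u_i)^{1-l_i}`. -/
def qProb {k : ℕ} (u : Fin k → ℝ) (l : Fin k → Bool) : ℝ :=
  ∏ i : Fin k, if l i then u i else 1 - u i

/-- The top `k` coordinates `(ω_{n-k+1}, …, ω_n)` of a length-`n` vector. -/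
def topCoords {n k : ℕ} (hk : k ≤ n) (ω : Fin n → ℝ) : Fin k → ℝ :=
  fun i => ω ⟨n - k + i.val, by omega⟩

/-- The vector `v_l`: `k - m` copies of `p01`, then `τ(ω_1),…,τ(ω_{n-k})`,
then `m` copies of `p11`, where `m` is the number of ones in `l`. -/
def vl {n : ℕ} (k : ℕ) (p01 p11 : ℝ) (ω : Fin n → ℝ) (m : ℕ) : Fin n → ℝ :=
  fun j =>
    if j.val < k - m then p01
    else if j.val < n - m then tauF p01 p11 (ω ⟨j.val - (k - m), by omega⟩)
    else p11

/-- The greedy-policy value functions `W`, indexed by the number of remaining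
steps (`r = 0` corresponds to the terminal time `T`). -/
def Wval (n k : ℕ) (hk : k ≤ n) (p01 p11 β : ℝ) : ℕ → (Fin n → ℝ) → ℝ
  | 0, ω => ∑ i : Fin n, if n - k ≤ i.val then ω i else 0
  | r + 1, ω =>
      (∑ i : Fin n, if n - k ≤ i.val then ω i else 0) +
        β * ∑ l : Fin k → Bool,
          qProb (topCoords hk ω) l *
            Wval n k hk p01 p11 β r (vl k p01 p11 ω (countTrue l))

/-- The updated information state `ω^{a,s}`. -/
def nextState {n : ℕ} (p01 p11 : ℝ) (ω : Fin n → ℝ) (a : Finset (Fin n))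
    (s : {i // i ∈ a} → Bool) : Fin n → ℝ :=
  fun j => if h : j ∈ a then (if s ⟨j, h⟩ then p11 else p01) else tauF p01 p11 (ω j)

/-- The probability of the realization `s` of the selected channels `a`. -/
def obsProb {n : ℕ} (ω : Fin n → ℝ) (a : Finset (Fin n))
    (s : {i // i ∈ a} → Bool) : ℝ :=
  ∏ i : {i // i ∈ a}, if s i then ω i.val else 1 - ω i.val

/-- The optimal value functions `V`, indexed by the number of remaining steps. -/
def Vval (n k : ℕ) (hk : k ≤ n) (p01 p11 β : ℝ) : ℕ → (Fin n → ℝ) → ℝ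
  | 0, ω => (actions n k).sup' (actions_nonempty hk) fun a => ∑ i ∈ a, ω i
  | r + 1, ω =>
      (actions n k).sup' (actions_nonempty hk) fun a =>
        (∑ i ∈ a, ω i) +
          β * ∑ s : {i // i ∈ a} → Bool,
            obsProb ω a s * Vval n k hk p01 p11 β r (nextState p01 p11 ω a s)

/-- `Q_t(ω, a)`: the value of taking action `a` now and acting optimally
afterwards, indexed by the number of remaining steps. -/
def Qval (n k : ℕ) (hk : k ≤ n) (p01 p11 β : ℝ) : ℕ → (Fin n → ℝ) → Finset (Fin n) → ℝ
  | 0, ω, a => ∑ i ∈ a, ω i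
  | r + 1, ω, a =>
      (∑ i ∈ a, ω i) +
        β * ∑ s : {i // i ∈ a} → Bool,
          obsProb ω a s * Vval n k hk p01 p11 β r (nextState p01 p11 ω a s)

/-- Replace the coordinates in positions `j` and `j+1` (`0`-indexed) by `x` and `y`. -/
def upd2 {n : ℕ} (ω : Fin n → ℝ) (j : ℕ) (hj : j + 1 < n) (x y : ℝ) : Fin n → ℝ :=
  Function.update (Function.update ω ⟨j, by omega⟩ x) ⟨j + 1, hj⟩ y

/-- The cyclic shift `(ω_2, …, ω_n, ω_1)`. -/
def cyc {n : ℕ} (hn : 0 < n) (ω : Fin n → ℝ) : Fin n → ℝ :=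
  fun j => ω ⟨(j.val + 1) % n, Nat.mod_lt _ hn⟩

end

/-- Expectation of `g` at the number of successes of independent Bernoulli trials whose
success probabilities are the entries of the list. -/
def bernoulliExp : List ℝ → (ℕ → ℝ) → ℝ
  | [], g => g 0
  | u :: us, g => u * bernoulliExp us (fun m => g (m + 1)) + (1 - u) * bernoulliExp us g

lemma bernoulliExp_perm {u v : List ℝ} (h : u.Perm v) (g : ℕ → ℝ) :
    bernoulliExp u g = bernoulliExp v g := by
  induction h generalizing g with
  | nil => rfl
  | cons x _ ih => simp only [bernoulliExp, ih]
  | swap x y l => simp only [bernoulliExp]; ring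
  | trans _ _ ih₁ ih₂ => rw [ih₁, ih₂]

lemma bernoulliExp_mono {u : List ℝ} (hu : ∀ x ∈ u, x ∈ Set.Icc (0:ℝ) 1) {f g : ℕ → ℝ}
    (h : ∀ m ≤ u.length, f m ≤ g m) : bernoulliExp u f ≤ bernoulliExp u g := by
  induction u generalizing f g with
  | nil => exact h 0 le_rfl
  | cons x u ih =>
    have hx := hu x (by simp)
    have hu' : ∀ x ∈ u, x ∈ Set.Icc (0:ℝ) 1 := fun z hz => hu z (by simp [hz])
    have h₁ := ih hu' (f := fun m => f (m + 1)) (g := fun m => g (m + 1))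
      (fun m hm => h _ (by simpa using hm))
    have h₂ := ih hu' (f := f) (g := g) (fun m hm => h _ (by simp; omega))
    exact add_le_add (mul_le_mul_of_nonneg_left h₁ hx.1)
      (mul_le_mul_of_nonneg_left h₂ (sub_nonneg.2 hx.2))

lemma bernoulliExp_linear (u : List ℝ) (a b : ℝ) (f g : ℕ → ℝ) :
    bernoulliExp u (fun m => a * f m + b * g m) =
      a * bernoulliExp u f + b * bernoulliExp u g := by
  induction u generalizing f g with
  | nil => rfl
  | cons x u ih => simp only [bernoulliExp, ih]; ring

lemma bernoulliExp_const (u : List ℝ) (c : ℝ) : bernoulliExp u (fun _ => c) = c := by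
  induction u with
  | nil => rfl
  | cons x u ih => simp only [bernoulliExp, ih]; ring

lemma bernoulliExp_const_add_mul (u : List ℝ) (c b : ℝ) (g : ℕ → ℝ) :
    bernoulliExp u (fun m => c + b * g m) = c + b * bernoulliExp u g := by
  simpa [bernoulliExp_const] using bernoulliExp_linear u 1 b (fun _ => c) g

lemma bernoulliExp_affine (u v : List ℝ) (a x y : ℝ) (g : ℕ → ℝ) :
    bernoulliExp (u ++ (a * x + (1 - a) * y) :: v) g =
      a * bernoulliExp (u ++ x :: v) g + (1 - a) * bernoulliExp (u ++ y :: v) g := by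
  rw [bernoulliExp_perm List.perm_middle, bernoulliExp_perm (List.perm_middle (a := x)),
    bernoulliExp_perm (List.perm_middle (a := y))]
  simp only [bernoulliExp]; ring

/-- List form of `vl`: the state reached when `m` of the `k` observed channels are good and
`b` lists the beliefs of the unobserved ones. -/
def postList (k : ℕ) (p q : ℝ) (b : List ℝ) (m : ℕ) : List ℝ :=
  List.replicate (k - m) p ++ b.map (tauF p q) ++ List.replicate m q

/-- List form of the greedy value, with `r` stages to go and `d` unobserved channels. -/
def greedyList (d k : ℕ) (p q β : ℝ) : ℕ → List ℝ → ℝ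
  | 0, _ => 0
  | r + 1, l => (l.drop d).sum +
      β * bernoulliExp (l.drop d) (fun m => greedyList d k p q β r (postList k p q (l.take d) m))

lemma greedyList_succ_append {d k : ℕ} (p q β : ℝ) (r : ℕ) {b : List ℝ} (hb : b.length = d)
    (u : List ℝ) :
    greedyList d k p q β (r + 1) (b ++ u) =
      u.sum + β * bernoulliExp u (fun m => greedyList d k p q β r (postList k p q b m)) := by
  subst hb
  simp [greedyList]

lemma postList_middle (k : ℕ) (p q : ℝ) (b c : List ℝ) (x : ℝ) (m : ℕ) :
    postList k p q (b ++ x :: c) m =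
      (List.replicate (k - m) p ++ b.map (tauF p q)) ++
        tauF p q x :: (c.map (tauF p q) ++ List.replicate m q) := by
  simp [postList]

lemma tauF_mem_Icc {p q x : ℝ} (h : p ≤ q) (hx : x ∈ Set.Icc (0:ℝ) 1) :
    tauF p q x ∈ Set.Icc p q := by
  obtain ⟨h₀, h₁⟩ := hx
  unfold tauF
  constructor <;> nlinarith

lemma tauF_mono {p q : ℝ} (h : p ≤ q) : Monotone (tauF p q) := by
  intro x y hxy
  unfold tauF
  nlinarith

lemma postList_pairwise {k : ℕ} {p q : ℝ} (h : p ≤ q) {b : List ℝ}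
    (hb : ∀ x ∈ b, x ∈ Set.Icc (0:ℝ) 1) (hs : b.Pairwise (· ≤ ·)) (m : ℕ) :
    (postList k p q b m).Pairwise (· ≤ ·) := by
  have hmap : (b.map (tauF p q)).Pairwise (· ≤ ·) :=
    List.pairwise_map.2 (hs.imp fun hxy => tauF_mono h hxy)
  have hτ : ∀ x ∈ b, p ≤ tauF p q x ∧ tauF p q x ≤ q := fun x hx => tauF_mem_Icc h (hb x hx)
  simp only [postList, List.pairwise_append, List.pairwise_replicate, List.mem_append,
    List.mem_replicate, List.mem_map]
  refine ⟨⟨by simp, hmap, ?_⟩, by simp, ?_⟩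
  · rintro _ ⟨_, rfl⟩ _ ⟨z, hz, rfl⟩
    exact (hτ z hz).1
  · rintro _ (⟨_, rfl⟩ | ⟨z, hz, rfl⟩) _ ⟨_, rfl⟩
    · exact h
    · exact (hτ z hz).2

lemma exists_append_of_le_length {α : Type*} {l : List α} {d : ℕ} (h : d ≤ l.length) :
    ∃ b u, l = b ++ u ∧ b.length = d :=
  ⟨l.take d, l.drop d, by simp, by simpa using h⟩

/-- The greedy value is affine in each coordinate. -/
lemma greedyList_affine {d k : ℕ} (p q β : ℝ) (r : ℕ) {l₁ l₂ : List ℝ}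
    (hl : d ≤ l₁.length + 1 + l₂.length) (a x y : ℝ) :
    greedyList d k p q β r (l₁ ++ (a * x + (1 - a) * y) :: l₂) =
      a * greedyList d k p q β r (l₁ ++ x :: l₂) +
        (1 - a) * greedyList d k p q β r (l₁ ++ y :: l₂) := by
  induction r generalizing l₁ l₂ a x y with
  | zero => simp [greedyList]
  | succ r ih =>
    rcases le_or_gt d l₁.length with h | h
    · obtain ⟨b, u, rfl, hb⟩ := exists_append_of_le_length h
      simp only [List.append_assoc, greedyList_succ_append p q β r hb, bernoulliExp_affine,
        List.sum_append, List.sum_cons]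
      ring
    · obtain ⟨c, u, rfl, hc⟩ :=
        exists_append_of_le_length (l := l₂) (d := d - l₁.length - 1) (by omega)
      have split : ∀ z, l₁ ++ z :: (c ++ u) = (l₁ ++ z :: c) ++ u := by simp
      have hlen : ∀ z, (l₁ ++ z :: c).length = d := by intro z; simp; omega
      have hτ : tauF p q (a * x + (1 - a) * y) = a * tauF p q x + (1 - a) * tauF p q y := by
        unfold tauF; ring
      simp only [split, greedyList_succ_append p q β r (hlen _), postList_middle, hτ]
      have key : ∀ m, d ≤ (List.replicate (k - m) p ++ l₁.map (tauF p q)).length + 1 +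
          (c.map (tauF p q) ++ List.replicate m q).length := by
        intro m; simp; omega
      simp only [ih (key _), bernoulliExp_linear]
      ring

lemma greedyList_tauF {d k : ℕ} (p q β : ℝ) (r : ℕ) {l₁ l₂ : List ℝ}
    (hl : d ≤ l₁.length + 1 + l₂.length) (x : ℝ) :
    greedyList d k p q β r (l₁ ++ tauF p q x :: l₂) =
      x * greedyList d k p q β r (l₁ ++ q :: l₂) +
        (1 - x) * greedyList d k p q β r (l₁ ++ p :: l₂) :=
  greedyList_affine p q β r hl x q p

lemma greedyList_perm_top {d k : ℕ} (p q β : ℝ) (r : ℕ) {b : List ℝ} (hb : b.length = d)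
    {u v : List ℝ} (h : u.Perm v) :
    greedyList d k p q β r (b ++ u) = greedyList d k p q β r (b ++ v) := by
  cases r with
  | zero => rfl
  | succ r => simp only [greedyList_succ_append p q β r hb, h.sum_eq, bernoulliExp_perm h]

/-- On lists of length `N` in the unit cube, putting adjacent entries in increasing order does
not decrease `F`. -/
def SwapMono (N : ℕ) (F : List ℝ → ℝ) : Prop :=
  ∀ (l₁ l₂ : List ℝ) (x y : ℝ), (∀ z ∈ l₁ ++ x :: y :: l₂, z ∈ Set.Icc (0:ℝ) 1) →
    l₁.length + l₂.length + 2 = N → x ≤ y → F (l₁ ++ y :: x :: l₂) ≤ F (l₁ ++ x :: y :: l₂)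

/-- On lists of length `N` in the unit cube, a cyclic shift loses at most `1`. -/
def CycBound (N : ℕ) (F : List ℝ → ℝ) : Prop :=
  ∀ (l : List ℝ) (x : ℝ), (∀ z ∈ x :: l, z ∈ Set.Icc (0:ℝ) 1) →
    l.length + 1 = N → F (x :: l) ≤ 1 + F (l ++ [x])

lemma replicate_append_cons {α : Type*} (n : ℕ) (x : α) (l : List α) :
    List.replicate n x ++ x :: l = x :: (List.replicate n x ++ l) := by
  induction n with
  | zero => rfl
  | succ n ih => rw [List.replicate_succ, List.cons_append, ih, List.cons_append]

lemma exchange_inequality {β x y s A C D E : ℝ} (hβ : β ∈ Set.Icc (0:ℝ) 1) (hxy : x ≤ y)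
    (h : D ≤ 1 + A) :
    x + s + β * (x * (y * C + (1 - y) * A) + (1 - x) * (y * D + (1 - y) * E)) ≤
      y + s + β * (y * (x * C + (1 - x) * A) + (1 - y) * (x * D + (1 - x) * E)) := by
  have h₁ : 0 ≤ β * (1 + A - D) := mul_nonneg hβ.1 (by linarith)
  have h₂ : 0 ≤ 1 + β * (A - D) := by linarith [hβ.2]
  linarith [mul_nonneg (sub_nonneg.2 hxy) h₂]

lemma shift_inequality {β a b s R₁₁ R₀₁ R₁₀ R₀₀ L₁₁ L₀₁ L₁₀ L₀₀ : ℝ}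
    (hβ : β ∈ Set.Icc (0:ℝ) 1) (ha : a ∈ Set.Icc (0:ℝ) 1) (hb : b ∈ Set.Icc (0:ℝ) 1)
    (h₁₁ : R₁₁ ≤ L₁₁) (h₀₁ : R₀₁ = L₀₁) (h₁₀ : R₁₀ ≤ 1 + L₁₀) (h₀₀ : R₀₀ ≤ 1 + L₀₀) :
    b + s + β * (b * (a * R₁₁ + (1 - a) * R₀₁) + (1 - b) * (a * R₁₀ + (1 - a) * R₀₀)) ≤
      1 + (a + s) + β * (a * (b * L₁₁ + (1 - b) * L₁₀) + (1 - a) * (b * L₀₁ + (1 - b) * L₀₀)) := by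
  subst h₀₁
  have ha' := sub_nonneg.2 ha.2
  have hb' := sub_nonneg.2 hb.2
  have k₁ := mul_nonneg (mul_nonneg hβ.1 (mul_nonneg ha.1 hb.1)) (sub_nonneg.2 h₁₁)
  have k₂ := mul_nonneg (mul_nonneg hβ.1 (mul_nonneg ha.1 hb')) (sub_nonneg.2 h₁₀)
  have k₃ := mul_nonneg (mul_nonneg hβ.1 (mul_nonneg ha' hb')) (sub_nonneg.2 h₀₀)
  have k₄ := mul_nonneg (sub_nonneg.2 hβ.2) hb'
  linarith [ha.1]

section Moves

variable {N : ℕ} {F : List ℝ → ℝ}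

lemma SwapMono.move_right (hF : SwapMono N F) (l₁ m l₂ : List ℝ) (y : ℝ)
    (hI : ∀ z ∈ l₁ ++ y :: (m ++ l₂), z ∈ Set.Icc (0:ℝ) 1)
    (hN : l₁.length + m.length + l₂.length + 1 = N) (hm : ∀ z ∈ m, z ≤ y) :
    F (l₁ ++ y :: (m ++ l₂)) ≤ F (l₁ ++ (m ++ y :: l₂)) := by
  induction m generalizing l₁ with
  | nil => simp
  | cons x m ih =>
    refine (hF l₁ (m ++ l₂) x y ?_ ?_ (hm x (by simp))).trans ?_
    · intro z hz; apply hI; simp at hz ⊢; tauto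
    · simp at hN ⊢; omega
    · simpa using ih (l₁ ++ [x]) (by intro z hz; apply hI; simp at hz ⊢; tauto)
        (by simp at hN ⊢; omega) (fun z hz => hm z (by simp [hz]))

lemma SwapMono.move_left (hF : SwapMono N F) (l₁ m l₂ : List ℝ) (x : ℝ)
    (hI : ∀ z ∈ l₁ ++ x :: (m ++ l₂), z ∈ Set.Icc (0:ℝ) 1)
    (hN : l₁.length + m.length + l₂.length + 1 = N) (hm : ∀ z ∈ m, x ≤ z) :
    F (l₁ ++ (m ++ x :: l₂)) ≤ F (l₁ ++ x :: (m ++ l₂)) := by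
  induction m generalizing l₁ with
  | nil => simp
  | cons y m ih =>
    refine le_trans ?_ (hF l₁ (m ++ l₂) x y ?_ ?_ (hm y (by simp)))
    · simpa using ih (l₁ ++ [y]) (by intro z hz; apply hI; simp at hz ⊢; tauto)
        (by simp at hN ⊢; omega) (fun z hz => hm z (by simp [hz]))
    · intro z hz; apply hI; simp at hz ⊢; tauto
    · simp at hN ⊢; omega

lemma SwapMono.le_orderedInsert (hF : SwapMono N F) (l₁ l : List ℝ) (x : ℝ)
    (hI : ∀ z ∈ l₁ ++ x :: l, z ∈ Set.Icc (0:ℝ) 1) (hN : l₁.length + l.length + 1 = N) :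
    F (l₁ ++ x :: l) ≤ F (l₁ ++ l.orderedInsert (· ≤ ·) x) := by
  induction l generalizing l₁ with
  | nil => simp
  | cons y l ih =>
    by_cases h : x ≤ y
    · simp [h]
    · rw [List.orderedInsert_cons, if_neg h]
      refine (hF l₁ l y x ?_ ?_ (le_of_not_ge h)).trans ?_
      · intro z hz; apply hI; simp at hz ⊢; tauto
      · simp at hN ⊢; omega
      · simpa using ih (l₁ ++ [y]) (by intro z hz; apply hI; simp at hz ⊢; tauto)
          (by simp at hN ⊢; omega)

lemma SwapMono.le_insertionSort (hF : SwapMono N F) (l₁ l : List ℝ)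
    (hI : ∀ z ∈ l₁ ++ l, z ∈ Set.Icc (0:ℝ) 1) (hN : l₁.length + l.length = N) :
    F (l₁ ++ l) ≤ F (l₁ ++ l.insertionSort (· ≤ ·)) := by
  induction l generalizing l₁ with
  | nil => simp
  | cons x l ih =>
    rw [List.insertionSort_cons]
    refine le_trans ?_ (hF.le_orderedInsert l₁ _ x ?_ ?_)
    · simpa using ih (l₁ ++ [x]) (by simpa using hI) (by simp at hN ⊢; omega)
    · intro z hz; apply hI; simpa using hz
    · simp at hN ⊢; omega

lemma SwapMono.le_of_perm (hF : SwapMono N F) {l l' : List ℝ} (hp : l.Perm l')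
    (hs : l'.Pairwise (· ≤ ·)) (hI : ∀ z ∈ l, z ∈ Set.Icc (0:ℝ) 1) (hN : l.length = N) :
    F l ≤ F l' := by
  have h := hF.le_insertionSort [] l (by simpa using hI) (by simpa using hN)
  have : l.insertionSort (· ≤ ·) = l' :=
    ((List.perm_insertionSort _ l).trans hp).eq_of_pairwise'
      (List.pairwise_insertionSort _ l) hs
  simpa [this] using h

lemma SwapMono.cons_le_one_add (hF : SwapMono N F) (hC : CycBound N F) (l₁ l₂ : List ℝ) (x : ℝ)
    (hI : ∀ z ∈ l₁ ++ x :: l₂, z ∈ Set.Icc (0:ℝ) 1)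
    (hN : l₁.length + l₂.length + 1 = N) (hx : ∀ z ∈ l₂, x ≤ z) :
    F (x :: (l₁ ++ l₂)) ≤ 1 + F (l₁ ++ x :: l₂) := by
  have h₁ := hC (l₁ ++ l₂) x (by intro z hz; apply hI; simp at hz ⊢; tauto) (by simpa using hN)
  have h₂ := hF.move_left l₁ l₂ [] x (by simpa using hI) (by simpa using hN) hx
  simp only [List.append_assoc, List.append_nil] at h₁ h₂
  linarith

end Moves

section Step

variable {d k r : ℕ} {p q β : ℝ}

lemma swapMono_greedyList_succ (hp : 0 ≤ p) (hq : q ≤ 1) (hpq : p ≤ q) (hβ : β ∈ Set.Icc (0:ℝ) 1)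
    (hS : SwapMono (d + k) (greedyList d k p q β r))
    (hC : CycBound (d + k) (greedyList d k p q β r)) :
    SwapMono (d + k) (greedyList d k p q β (r + 1)) := by
  intro l₁ l₂ x y hI hN hxy
  have hpI : p ∈ Set.Icc (0:ℝ) 1 := ⟨hp, hpq.trans hq⟩
  have hqI : q ∈ Set.Icc (0:ℝ) 1 := ⟨hp.trans hpq, hq⟩
  have hτI : ∀ z, z ∈ Set.Icc (0:ℝ) 1 → tauF p q z ∈ Set.Icc (0:ℝ) 1 := fun z hz =>
    ⟨hp.trans (tauF_mem_Icc hpq hz).1, (tauF_mem_Icc hpq hz).2.trans hq⟩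
  rcases le_or_gt d l₁.length with h | h
  · obtain ⟨b, u, rfl, hb⟩ := exists_append_of_le_length h
    rw [List.append_assoc, List.append_assoc]
    exact (greedyList_perm_top p q β _ hb ((List.Perm.swap _ _ _).append_left u)).le
  · rcases (Nat.succ_le_of_lt h).eq_or_lt with h' | h'
    · have split : ∀ z w, l₁ ++ z :: w :: l₂ = (l₁ ++ [z]) ++ (w :: l₂) := by simp
      have hlen : ∀ z, (l₁ ++ [z]).length = d := by intro z; simp; omega
      have hU : ∀ z ∈ l₂, z ∈ Set.Icc (0:ℝ) 1 := fun z hz => hI z (by simp [hz])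
      have key : ∀ m, d ≤ (List.replicate (k - m) p ++ l₁.map (tauF p q)).length + 1 +
          ([].map (tauF p q) ++ List.replicate m q).length := by
        intro m; simp; omega
      simp only [split, greedyList_succ_append p q β r (hlen _), postList_middle,
        greedyList_tauF p q β r (key _), bernoulliExp, List.sum_cons]
      rw [← bernoulliExp_linear, ← bernoulliExp_linear, ← bernoulliExp_const_add_mul,
        ← bernoulliExp_const_add_mul]
      refine bernoulliExp_mono hU fun m hm => ?_
      have hmk : k - m = (k - (m + 1)) + 1 := by omega
      have hK := hS.cons_le_one_add hC
        (List.replicate (k - (m + 1)) p ++ l₁.map (tauF p q)) (List.replicate (m + 1) q) p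
        (by
          intro z hz
          simp only [List.mem_append, List.mem_cons, List.mem_replicate, List.mem_map] at hz
          rcases hz with (⟨_, rfl⟩ | ⟨w, hw, rfl⟩) | rfl | ⟨_, rfl⟩
          · exact hpI
          · exact hτI w (hI w (by simp [hw]))
          · exact hpI
          · exact hqI)
        (by simp; omega) (by simp [hpq])
      refine exchange_inequality hβ hxy ?_
      simpa [hmk, List.replicate_succ, replicate_append_cons] using hK
    · obtain ⟨c, u, rfl, hc⟩ :=
        exists_append_of_le_length (l := l₂) (d := d - l₁.length - 2) (by omega)
      have split : ∀ z w, l₁ ++ z :: w :: (c ++ u) = (l₁ ++ z :: w :: c) ++ u := by simp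
      have hlen : ∀ z w, (l₁ ++ z :: w :: c).length = d := by intro z w; simp; omega
      simp only [split, greedyList_succ_append p q β r (hlen _ _)]
      refine add_le_add le_rfl (mul_le_mul_of_nonneg_left (bernoulliExp_mono ?_ ?_) hβ.1)
      · exact fun z hz => hI z (by simp [hz])
      · intro m hm
        simp only [postList_middle, List.map_cons, List.cons_append]
        have hmk : m ≤ k := by simp at hN; omega
        refine hS _ _ _ _ ?_ ?_ (tauF_mono hpq hxy)
        · intro z hz
          simp only [List.mem_append, List.mem_cons, List.mem_replicate, List.mem_map] at hz
          rcases hz with (⟨_, rfl⟩ | ⟨w, hw, rfl⟩) | rfl | rfl | ⟨w, hw, rfl⟩ | ⟨_, rfl⟩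
          · exact hpI
          · exact hτI w (hI w (by simp [hw]))
          · exact hτI _ (hI _ (by simp))
          · exact hτI _ (hI _ (by simp))
          · exact hτI w (hI w (by simp [hw]))
          · exact hqI
        · simp; omega

lemma cycBound_greedyList_succ (hk : 1 ≤ k) (hp : 0 ≤ p) (hq : q ≤ 1) (hpq : p ≤ q)
    (hβ : β ∈ Set.Icc (0:ℝ) 1)
    (hS : SwapMono (d + k) (greedyList d k p q β r))
    (hC : CycBound (d + k) (greedyList d k p q β r)) :
    CycBound (d + k) (greedyList d k p q β (r + 1)) := by
  intro l a hI hN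
  have hpI : p ∈ Set.Icc (0:ℝ) 1 := ⟨hp, hpq.trans hq⟩
  have hqI : q ∈ Set.Icc (0:ℝ) 1 := ⟨hp.trans hpq, hq⟩
  rcases Nat.eq_zero_or_pos d with rfl | hd
  · have h := greedyList_perm_top (d := 0) (k := k) p q β (r + 1) (b := []) rfl
      (List.perm_append_singleton a l)
    simp only [List.nil_append] at h
    linarith
  · obtain ⟨M, u, rfl, hM⟩ :=
      exists_append_of_le_length (l := l) (d := d - 1) (by omega)
    obtain ⟨b, U, rfl⟩ := List.exists_cons_of_length_pos (l := u) (by simp at hN; omega)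
    have ha := hI a (by simp)
    have hb := hI b (by simp)
    have hU : ∀ z ∈ U, z ∈ Set.Icc (0:ℝ) 1 := fun z hz => hI z (by simp [hz])
    have hUk : U.length + 1 = k := by simp at hN; omega
    have hτM : ∀ z ∈ M.map (tauF p q), z ∈ Set.Icc p q := by
      intro z hz
      obtain ⟨w, hw, rfl⟩ := List.mem_map.1 hz
      exact tauF_mem_Icc hpq (hI w (by simp [hw]))
    have hτM' : ∀ z ∈ M.map (tauF p q), z ∈ Set.Icc (0:ℝ) 1 := fun z hz =>
      ⟨hp.trans (hτM z hz).1, (hτM z hz).2.trans hq⟩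
    have hMlen : (M.map (tauF p q)).length = d - 1 := by simpa using hM
    rw [show a :: (M ++ b :: U) = ([] ++ a :: M) ++ (b :: U) by simp,
      show M ++ b :: U ++ [a] = (M ++ [b]) ++ (U ++ [a]) by simp,
      greedyList_perm_top p q β _ (by simp; omega) (List.perm_append_singleton a U),
      greedyList_succ_append p q β r (by simp; omega),
      greedyList_succ_append p q β r (by simp; omega)]
    have key₁ : ∀ m, d ≤ (List.replicate (k - m) p ++ [].map (tauF p q)).length + 1 +
        (M.map (tauF p q) ++ List.replicate m q).length := by
      intro m; simp; omega
    have key₂ : ∀ m, d ≤ (List.replicate (k - m) p ++ M.map (tauF p q)).length + 1 +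
        ([].map (tauF p q) ++ List.replicate m q).length := by
      intro m; simp; omega
    simp only [postList_middle, greedyList_tauF p q β r (key₁ _),
      greedyList_tauF p q β r (key₂ _), bernoulliExp, List.sum_cons]
    rw [← bernoulliExp_linear, ← bernoulliExp_linear, ← bernoulliExp_const_add_mul, ← add_assoc,
      ← bernoulliExp_const_add_mul]
    refine bernoulliExp_mono hU fun m hm => ?_
    obtain ⟨j, hj⟩ : ∃ j, k = m + 1 + j := ⟨k - (m + 1), by omega⟩
    have hj₁ : k - (m + 1) = j := by omega
    have hj₂ : k - m = j + 1 := by omega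
    simp only [hj₁, hj₂, List.map_nil, List.nil_append, List.append_nil]
    generalize M.map (tauF p q) = M' at *
    have hmem : ∀ i₁ i₂ z, z ∈ List.replicate i₁ p ∨ z ∈ M' ∨ z = p ∨ z = q ∨
        z ∈ List.replicate i₂ q → z ∈ Set.Icc (0:ℝ) 1 := by
      rintro i₁ i₂ z (h | h | rfl | rfl | h)
      · rwa [(List.mem_replicate.1 h).2]
      · exact hτM' z h
      · exact hpI
      · exact hqI
      · rwa [(List.mem_replicate.1 h).2]
    have h₀₀ := hS.cons_le_one_add hC (List.replicate (j + 1) p ++ M') (List.replicate m q) p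
      (by intro z hz; apply hmem (j + 1) m; simp only [List.mem_append, List.mem_cons] at hz; tauto)
      (by simp; omega) (by simp [hpq])
    have h₁₁ := hS.move_right (List.replicate j p) M' (List.replicate (m + 1) q) q
      (by intro z hz; apply hmem j (m + 1); simp only [List.mem_append, List.mem_cons] at hz; tauto)
      (by simp; omega) (fun z hz => (hτM z hz).2)
    have h₁₀ := (hS.move_right (List.replicate (j + 1) p) M' (List.replicate m q) q
      (by intro z hz; apply hmem (j + 1) m; simp only [List.mem_append, List.mem_cons] at hz; tauto)
      (by simp; omega) (fun z hz => (hτM z hz).2)).trans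
      (by
        simpa [List.replicate_succ] using
          hS.cons_le_one_add hC (List.replicate j p ++ M') (List.replicate (m + 1) q) p
            (by
              intro z hz; apply hmem j (m + 1)
              simp only [List.mem_append, List.mem_cons] at hz; tauto)
            (by simp; omega) (by simp [hpq]))
    refine shift_inequality hβ ha hb ?_ ?_ ?_ ?_
    · simpa using h₁₁
    · refine congrArg _ ?_
      simp [List.replicate_succ, replicate_append_cons]
    · simpa [List.replicate_succ] using h₁₀
    · simpa [List.replicate_succ, replicate_append_cons] using h₀₀

end Step

lemma swapMono_cycBound_greedyList {d k : ℕ} {p q β : ℝ} (hk : 1 ≤ k) (hp : 0 ≤ p) (hq : q ≤ 1)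
    (hpq : p ≤ q) (hβ : β ∈ Set.Icc (0:ℝ) 1) (r : ℕ) :
    SwapMono (d + k) (greedyList d k p q β r) ∧ CycBound (d + k) (greedyList d k p q β r) := by
  induction r with
  | zero =>
    exact ⟨fun _ _ _ _ _ _ _ => le_rfl, fun _ _ _ _ => by simp [greedyList]⟩
  | succ r ih =>
    exact ⟨swapMono_greedyList_succ hp hq hpq hβ ih.1 ih.2,
      cycBound_greedyList_succ hk hp hq hpq hβ ih.1 ih.2⟩

lemma countTrue_cons {k : ℕ} (c : Bool) (l : Fin k → Bool) :
    countTrue (Fin.cons c l : Fin (k + 1) → Bool) = countTrue l + if c then 1 else 0 := by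
  unfold countTrue
  rw [Finset.card_filter, Finset.card_filter, Fin.sum_univ_succ, add_comm]
  simp

lemma sum_qProb_mul {k : ℕ} (u : Fin k → ℝ) (g : ℕ → ℝ) :
    ∑ l : Fin k → Bool, qProb u l * g (countTrue l) = bernoulliExp (List.ofFn u) g := by
  induction k generalizing g with
  | zero => simp [qProb, countTrue, bernoulliExp]
  | succ k ih =>
    rw [← (Fin.consEquiv fun _ : Fin (k + 1) => Bool).sum_comp, Fintype.sum_prod_type]
    simp only [Fintype.sum_bool, Fin.consEquiv_apply, qProb, Fin.prod_univ_succ,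
      Fin.cons_zero, Fin.cons_succ, List.ofFn_succ, bernoulliExp, mul_assoc, ← Finset.mul_sum]
    simp only [← ih, qProb, Fin.consEquiv, Equiv.coe_fn_mk, countTrue_cons]
    simp

lemma countTrue_le {k : ℕ} (l : Fin k → Bool) : countTrue l ≤ k := by
  simpa [countTrue] using Finset.card_filter_le (Finset.univ : Finset (Fin k)) (fun i => l i = true)

lemma ofFn_vl {d k m : ℕ} (hm : m ≤ k) (p q : ℝ) (ω : Fin (d + k) → ℝ) :
    List.ofFn (vl k p q ω m) =
      postList k p q (List.ofFn fun i : Fin d => ω (Fin.castAdd k i)) m := by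
  apply List.ext_getElem
  · simp [postList]; omega
  · intro j h₁ h₂
    simp only [List.getElem_ofFn, vl, postList, List.getElem_append, List.getElem_replicate,
      List.getElem_map, List.length_append, List.length_replicate, List.length_map,
      List.length_ofFn]
    split_ifs <;> first | rfl | (exfalso; omega)

lemma ofFn_eq_append {α : Type*} {d k : ℕ} (f : Fin (d + k) → α) :
    List.ofFn f = (List.ofFn fun i : Fin d => f (Fin.castAdd k i)) ++
      List.ofFn fun i : Fin k => f (Fin.natAdd d i) :=
  List.ofFn_add

lemma sum_top_eq {d k : ℕ} (ω : Fin (d + k) → ℝ) :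
    (∑ i : Fin (d + k), if d + k - k ≤ i.val then ω i else 0) =
      (List.ofFn fun i => ω (Fin.natAdd d i)).sum := by
  rw [Fin.sum_univ_add, List.sum_ofFn]
  simp [Fin.is_lt, Nat.not_le.2]

lemma topCoords_eq {d k : ℕ} (hk : k ≤ d + k) (ω : Fin (d + k) → ℝ) :
    topCoords hk ω = fun i => ω (Fin.natAdd d i) := by
  funext i
  exact congrArg ω (Fin.ext (by simp))

lemma Wval_eq_greedyList {d k : ℕ} (hk : k ≤ d + k) (p q β : ℝ) (r : ℕ) (ω : Fin (d + k) → ℝ) :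
    Wval (d + k) k hk p q β r ω = greedyList d k p q β (r + 1) (List.ofFn ω) := by
  induction r generalizing ω with
  | zero =>
    rw [ofFn_eq_append, greedyList_succ_append _ _ _ _ (by simp)]
    simp only [Wval, sum_top_eq]
    simp [greedyList, bernoulliExp_const]
  | succ r ih =>
    rw [ofFn_eq_append, greedyList_succ_append _ _ _ _ (by simp)]
    simp only [Wval, sum_top_eq]
    rw [← sum_qProb_mul, topCoords_eq]
    congr 2
    refine Finset.sum_congr rfl fun l _ => ?_
    rw [ih, ofFn_vl (countTrue_le l)]

lemma map_val_eq_map_univ {ι α : Type*} (a : Finset ι) (f : ι → α) :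
    a.val.map f = (Finset.univ : Finset {i // i ∈ a}).val.map (fun i => f i.val) :=
  (Multiset.attach_map_val' a.val f).symm

lemma sum_obsProb_mul {n : ℕ} (ω : Fin n → ℝ) (a : Finset (Fin n)) {u : List ℝ}
    (hu : (u : Multiset ℝ) = a.val.map ω) (g : ℕ → ℝ) :
    ∑ s : {i // i ∈ a} → Bool, obsProb ω a s * g (Finset.univ.filter fun i => s i = true).card =
      bernoulliExp u g := by
  let e := a.equivFin
  have hperm : u.Perm (List.ofFn fun j => ω (e.symm j)) := by
    rw [← Multiset.coe_eq_coe, hu, map_val_eq_map_univ, ← Fin.univ_val_map,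
      ← Multiset.map_univ_val_equiv e, Multiset.map_map]
    simp
  rw [bernoulliExp_perm hperm, ← sum_qProb_mul, ← (e.arrowCongr (Equiv.refl Bool)).sum_comp]
  refine Finset.sum_congr rfl fun s _ => ?_
  congr 2
  · rw [obsProb, qProb, ← e.prod_comp]
    simp
  · rw [countTrue, Finset.card_filter, Finset.card_filter, ← e.sum_comp]
    simp

lemma map_ite_univ {ι α : Type*} [Fintype ι] (s : ι → Bool) (p q : α) :
    (Finset.univ : Finset ι).val.map (fun i => if s i then q else p) =
      Multiset.replicate (Fintype.card ι - (Finset.univ.filter fun i => s i = true).card) p +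
        Multiset.replicate (Finset.univ.filter fun i => s i = true).card q := by
  classical
  rw [← Finset.card_compl, ← Multiset.filter_add_not (fun i => s i = true) (Finset.univ : Finset ι).val,
    Multiset.map_add, add_comm]
  congr 1
  · rw [Multiset.map_congr rfl (g := fun _ => p) (by simp +contextual), Multiset.map_const',
      ← Finset.filter_val, ← Finset.compl_filter]
    rfl
  · rw [Multiset.map_congr rfl (g := fun _ => q) (by simp +contextual), Multiset.map_const']
    rfl

lemma map_univ_eq_add_compl {ι α : Type*} [Fintype ι] [DecidableEq ι] (a : Finset ι) (f : ι → α) :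
    (Finset.univ : Finset ι).val.map f = a.val.map f + aᶜ.val.map f := by
  rw [← Multiset.map_add, ← Finset.disjUnion_val _ _ disjoint_compl_right,
    Finset.disjUnion_eq_union, Finset.union_compl]

lemma map_nextState {n k : ℕ} (p q : ℝ) (ω : Fin n → ℝ) {a : Finset (Fin n)} (ha : a.card = k)
    {b : List ℝ} (hb : (b : Multiset ℝ) = aᶜ.val.map ω) (s : {i // i ∈ a} → Bool) :
    (postList k p q b (Finset.univ.filter fun i => s i = true).card : Multiset ℝ) =
      Finset.univ.val.map (nextState p q ω a s) := by
  have h₁ : a.val.map (nextState p q ω a s) =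
      (Finset.univ : Finset {i // i ∈ a}).val.map (fun i => if s i then q else p) := by
    rw [map_val_eq_map_univ]
    refine Multiset.map_congr rfl fun i _ => ?_
    simp [nextState]
  have h₂ : aᶜ.val.map (nextState p q ω a s) = (b.map (tauF p q) : Multiset ℝ) := by
    rw [← Multiset.map_coe, hb, Multiset.map_map]
    refine Multiset.map_congr rfl fun i hi => ?_
    have : i ∉ a := by simpa using hi
    simp [nextState, this]
  rw [map_univ_eq_add_compl a, h₁, h₂, map_ite_univ, Fintype.card_coe, ha]
  simp only [postList, ← Multiset.coe_add, ← Multiset.coe_replicate]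
  abel

lemma nextState_mem_Icc {n : ℕ} {p q : ℝ} (hp : 0 ≤ p) (hq : q ≤ 1) (hpq : p ≤ q)
    {ω : Fin n → ℝ} (hω : ∀ i, ω i ∈ Set.Icc (0:ℝ) 1) (a : Finset (Fin n))
    (s : {i // i ∈ a} → Bool) (j : Fin n) : nextState p q ω a s j ∈ Set.Icc (0:ℝ) 1 := by
  have hτ := tauF_mem_Icc hpq (hω j)
  unfold nextState
  split_ifs
  · exact ⟨hp.trans hpq, hq⟩
  · exact ⟨hp, hpq.trans hq⟩
  · exact ⟨hp.trans hτ.1, hτ.2.trans hq⟩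

lemma eq_ofFn_sort {n : ℕ} {ω : Fin n → ℝ} {l : List ℝ} (hs : l.Pairwise (· ≤ ·))
    (hl : (l : Multiset ℝ) = Finset.univ.val.map ω) : l = List.ofFn (ω ∘ Tuple.sort ω) := by
  rw [Fin.univ_val_map, Multiset.coe_eq_coe] at hl
  exact (hl.trans (Equiv.Perm.ofFn_comp_perm _ _).symm).eq_of_pairwise' hs
    (Tuple.monotone_sort ω).sortedLE_ofFn.pairwise

/-- Taking action `a` now, with continuation value `G` that agrees with `F` on sorted states. -/
lemma action_value_eq {d k r : ℕ} {p q β : ℝ} (hp : 0 ≤ p) (hq : q ≤ 1) (hpq : p ≤ q)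
    {G : (Fin (d + k) → ℝ) → ℝ}
    (hG : ∀ ω, (∀ i, ω i ∈ Set.Icc (0:ℝ) 1) →
      G ω = greedyList d k p q β r (List.ofFn (ω ∘ Tuple.sort ω)))
    {ω : Fin (d + k) → ℝ} (hω : ∀ i, ω i ∈ Set.Icc (0:ℝ) 1) {a : Finset (Fin (d + k))}
    (ha : a.card = k) {b u : List ℝ} (hs : b.Pairwise (· ≤ ·))
    (hb : (b : Multiset ℝ) = aᶜ.val.map ω) (hu : (u : Multiset ℝ) = a.val.map ω) :
    (∑ i ∈ a, ω i) +
        β * ∑ s : {i // i ∈ a} → Bool, obsProb ω a s * G (nextState p q ω a s) =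
      greedyList d k p q β (r + 1) (b ++ u) := by
  have hblen : b.length = d := by
    have := congrArg Multiset.card hb
    simp [Finset.card_compl, ha] at this
    omega
  have hbI : ∀ x ∈ b, x ∈ Set.Icc (0:ℝ) 1 := by
    intro x hx
    rw [← Multiset.mem_coe, hb, Multiset.mem_map] at hx
    obtain ⟨i, -, rfl⟩ := hx
    exact hω i
  have hsum : ∑ i ∈ a, ω i = u.sum := by
    rw [← Multiset.sum_coe, hu]; rfl
  rw [greedyList_succ_append p q β r hblen, hsum, ← sum_obsProb_mul ω a hu]
  congr 2
  refine Finset.sum_congr rfl fun s _ => ?_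
  rw [hG _ (nextState_mem_Icc hp hq hpq hω a s),
    ← eq_ofFn_sort (postList_pairwise hpq hbI hs _) (map_nextState p q ω ha hb s)]

lemma sup_action_value_eq {d k r : ℕ} {p q β : ℝ} (hk : k ≤ d + k) (hk1 : 1 ≤ k)
    (hp : 0 ≤ p) (hq : q ≤ 1) (hpq : p ≤ q) (hβ : β ∈ Set.Icc (0:ℝ) 1)
    {G : (Fin (d + k) → ℝ) → ℝ}
    (hG : ∀ ω, (∀ i, ω i ∈ Set.Icc (0:ℝ) 1) →
      G ω = greedyList d k p q β r (List.ofFn (ω ∘ Tuple.sort ω)))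
    {ω : Fin (d + k) → ℝ} (hω : ∀ i, ω i ∈ Set.Icc (0:ℝ) 1) :
    ((actions (d + k) k).sup' (actions_nonempty hk) fun a => (∑ i ∈ a, ω i) +
        β * ∑ s : {i // i ∈ a} → Bool, obsProb ω a s * G (nextState p q ω a s)) =
      greedyList d k p q β (r + 1) (List.ofFn (ω ∘ Tuple.sort ω)) := by
  have hperm : (List.ofFn (ω ∘ Tuple.sort ω)).Perm (List.ofFn ω) :=
    Equiv.Perm.ofFn_comp_perm _ _
  have hsorted : (List.ofFn (ω ∘ Tuple.sort ω)).Pairwise (· ≤ ·) :=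
    (Tuple.monotone_sort ω).sortedLE_ofFn.pairwise
  have huniv : (List.ofFn ω : Multiset ℝ) = Finset.univ.val.map ω :=
    (Fin.univ_val_map ω).symm
  apply le_antisymm
  · refine Finset.sup'_le _ _ fun a ha => ?_
    have hcard : a.card = k := (Finset.mem_powersetCard.1 ha).2
    have hb : (((aᶜ.val.map ω).sort (· ≤ ·) : List ℝ) : Multiset ℝ) = aᶜ.val.map ω :=
      Multiset.sort_eq _ _
    have hu : ((a.val.map ω).toList : Multiset ℝ) = a.val.map ω := Multiset.coe_toList _
    rw [action_value_eq hp hq hpq hG hω hcard (Multiset.pairwise_sort _ _) hb hu]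
    have hp' : ((aᶜ.val.map ω).sort (· ≤ ·) ++ (a.val.map ω).toList).Perm (List.ofFn ω) := by
      rw [← Multiset.coe_eq_coe, ← Multiset.coe_add, hb, hu, huniv, map_univ_eq_add_compl a,
        add_comm]
    refine (swapMono_cycBound_greedyList hk1 hp hq hpq hβ (r + 1)).1.le_of_perm
      (hp'.trans hperm.symm) hsorted ?_ (by simp)
    intro z hz
    obtain ⟨i, rfl⟩ := List.mem_ofFn.1 (hp'.subset hz)
    exact hω i
  · let σ := Tuple.sort ω
    let a : Finset (Fin (d + k)) :=
      Finset.univ.map ((Fin.natAddEmb d : Fin k ↪ Fin (d + k)).trans σ.toEmbedding)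
    have hcard : a.card = k := by simp [a]
    have hsplit : List.ofFn (ω ∘ σ) = List.ofFn (fun i : Fin d => (ω ∘ σ) (Fin.castAdd k i)) ++
        List.ofFn (fun i : Fin k => (ω ∘ σ) (Fin.natAdd d i)) := ofFn_eq_append _
    have hu : (List.ofFn (fun i : Fin k => (ω ∘ σ) (Fin.natAdd d i)) : Multiset ℝ) =
        a.val.map ω := by
      rw [Finset.map_val, Multiset.map_map, ← Fin.univ_val_map]
      rfl
    have hb : (List.ofFn (fun i : Fin d => (ω ∘ σ) (Fin.castAdd k i)) : Multiset ℝ) =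
        aᶜ.val.map ω := by
      have h : (List.ofFn (ω ∘ σ) : Multiset ℝ) = Finset.univ.val.map ω :=
        (Multiset.coe_eq_coe.2 hperm).trans huniv
      rw [hsplit, ← Multiset.coe_add, hu, map_univ_eq_add_compl a, add_comm] at h
      exact add_left_cancel h
    have hs : (List.ofFn (fun i : Fin d => (ω ∘ σ) (Fin.castAdd k i))).Pairwise (· ≤ ·) := by
      have := hsorted
      rw [hsplit] at this
      exact (List.pairwise_append.1 this).1
    rw [hsplit, ← action_value_eq hp hq hpq hG hω hcard hs hb hu]
    exact Finset.le_sup' (f := fun a => (∑ i ∈ a, ω i) +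
        β * ∑ s : {i // i ∈ a} → Bool, obsProb ω a s * G (nextState p q ω a s))
      (Finset.mem_powersetCard.2 ⟨Finset.subset_univ _, hcard⟩)

lemma Vval_eq_greedyList {d k : ℕ} {p q β : ℝ} (hk : k ≤ d + k) (hk1 : 1 ≤ k)
    (hp : 0 ≤ p) (hq : q ≤ 1) (hpq : p ≤ q) (hβ : β ∈ Set.Icc (0:ℝ) 1) (r : ℕ)
    {ω : Fin (d + k) → ℝ} (hω : ∀ i, ω i ∈ Set.Icc (0:ℝ) 1) :
    Vval (d + k) k hk p q β r ω =
      greedyList d k p q β (r + 1) (List.ofFn (ω ∘ Tuple.sort ω)) := by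
  induction r generalizing ω with
  | zero =>
    rw [← sup_action_value_eq hk hk1 hp hq hpq hβ (G := fun _ => 0) (fun _ _ => rfl) hω]
    simp [Vval]
  | succ r ih =>
    rw [← sup_action_value_eq hk hk1 hp hq hpq hβ (fun _ h => ih h) hω]
    rfl

/-- Under `p01 ≤ p11`, for every `t ∈ {1,…,T}` and `ω ∈ [0,1]^n`,
the optimal value equals the greedy-policy value at the increasingly sorted
state: `V_t(ω) = W_t(ω^↑)`. -/
theorem optimal_value_eq_greedy_value_sorted
    (n k T : ℕ) (hk1 : 1 ≤ k) (hkn : k ≤ n) (hT : 1 ≤ T)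
    (p01 p11 β : ℝ)
    (hp01 : p01 ∈ Set.Icc (0:ℝ) 1) (hp11 : p11 ∈ Set.Icc (0:ℝ) 1)
    (hβ : β ∈ Set.Icc (0:ℝ) 1) (hord : p01 ≤ p11)
    (t : ℕ) (ht1 : 1 ≤ t) (ht2 : t ≤ T)
    (ω : Fin n → ℝ) (hω : ∀ i, ω i ∈ Set.Icc (0:ℝ) 1) :
    Vval n k hkn p01 p11 β (T - t) ω =
      Wval n k hkn p01 p11 β (T - t) (ω ∘ (Tuple.sort ω)) := by
  obtain ⟨d, rfl⟩ : ∃ d, n = d + k := ⟨n - k, by omega⟩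
  rw [Vval_eq_greedyList hkn hk1 hp01.1 hp11.2 hord hβ _ hω, Wval_eq_greedyList]
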